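/- (Diagonal intersection) If H ⊆ FIN^[∞] is a Matet-adequate family and X_0 ≥ X_1 ≥ X_2 ≥ ⋯ is a ≤-descending sequence of members of H, then there exists X ∈ H with X ≤ X_0 such that for every s ∈ [X], the tail X/s (consisting of all blocks of X whose minimum exceeds max(s)) is a condensation of X_{max(s)+1}. -/

import Mathlib

/-- `blockLt s t` means every element of `s` is below every element of `t`
(for nonempty finite sets this is `max s < min t`). -/
def blockLt (s t : Finset ℕ) : Prop := ∀ a ∈ s, ∀ b ∈ t, a < b

/-- An infinite block sequence: a sequence of nonempty finite sets of naturals,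
each block entirely below the next. -/
def IsBlockSeq (X : ℕ → Finset ℕ) : Prop :=
  ∀ i, (X i).Nonempty ∧ blockLt (X i) (X (i + 1))

/-- A finite block sequence of length `n`. -/
def IsFinBlockSeq {n : ℕ} (a : Fin n → Finset ℕ) : Prop :=
  (∀ i, (a i).Nonempty) ∧ ∀ i j : Fin n, i < j → blockLt (a i) (a j)

/-- `s ∈ [X]`: `s` is the union of the blocks `X i` for `i` in some nonempty finite set. -/
def InUnions (X : ℕ → Finset ℕ) (s : Finset ℕ) : Prop :=
  ∃ I : Finset ℕ, I.Nonempty ∧ s = I.biUnion X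

/-- `Y ≤ X`: `Y` is a condensation of `X`, i.e. every block of `Y` is in `[X]`. -/
def Condensation (Y X : ℕ → Finset ℕ) : Prop := ∀ n, InUnions X (Y n)

/-- `Y ≤* X`: some tail of `Y` (all blocks whose elements exceed some `m`)
is a condensation of `X`. -/
def CondensationStar (Y X : ℕ → Finset ℕ) : Prop :=
  ∃ m : ℕ, ∀ i, (∀ a ∈ Y i, m < a) → InUnions X (Y i)

/-- A nonempty family `H ⊆ FIN^[∞]` is Matet-adequate. -/
def MatetAdequate (H : Set (ℕ → Finset ℕ)) : Prop :=
  H.Nonempty ∧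
  (∀ X ∈ H, IsBlockSeq X) ∧
  -- (i) closed under finite changes
  (∀ Y ∈ H, ∀ X : ℕ → Finset ℕ, IsBlockSeq X → {n | X n ≠ Y n}.Finite → X ∈ H) ∧
  -- (ii) closed ≤*-upwards
  (∀ Y ∈ H, ∀ X : ℕ → Finset ℕ, IsBlockSeq X → CondensationStar Y X → X ∈ H) ∧
  -- (iii) ≤-descending sequences have ≤*-lower bounds in H
  (∀ f : ℕ → ℕ → Finset ℕ, (∀ n, f n ∈ H) → (∀ n, Condensation (f (n + 1)) (f n)) →
    ∃ X ∈ H, ∀ n, CondensationStar X (f n)) ∧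
  -- (iv) Hindman property relative to H
  (∀ X ∈ H, ∀ c : Finset ℕ → Fin 2, ∃ Y ∈ H, Condensation Y X ∧
    ∃ j : Fin 2, ∀ s : Finset ℕ, InUnions Y s → c s = j)

theorem IsBlockSeq.blockLt_of_lt {X : ℕ → Finset ℕ} (hX : IsBlockSeq X) {i j : ℕ} (hij : i < j) :
    blockLt (X i) (X j) := by
  induction j, hij using Nat.le_induction with
  | base => exact (hX i).2
  | succ j _ ih =>
    intro a ha b hb
    obtain ⟨c, hc⟩ := (hX j).1
    exact (ih a ha c hc).trans ((hX j).2 c hc b hb)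

theorem IsBlockSeq.le_of_mem {X : ℕ → Finset ℕ} (hX : IsBlockSeq X) {i a : ℕ} (ha : a ∈ X i) :
    i ≤ a := by
  induction i generalizing a with
  | zero => exact Nat.zero_le a
  | succ i ih =>
    obtain ⟨c, hc⟩ := (hX i).1
    exact (ih hc).trans_lt ((hX i).2 c hc a ha)

theorem inUnions_apply (X : ℕ → Finset ℕ) (i : ℕ) : InUnions X (X i) :=
  ⟨{i}, Finset.singleton_nonempty i, by simp⟩

theorem InUnions.biUnion {X Z : ℕ → Finset ℕ} {I : Finset ℕ} (hI : I.Nonempty)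
    (h : ∀ i ∈ I, InUnions Z (X i)) : InUnions Z (I.biUnion X) := by
  choose! J hJ hXJ using h
  refine ⟨I.biUnion J, ?_, ?_⟩
  · obtain ⟨i, hi⟩ := hI
    exact Finset.Nonempty.mono (Finset.subset_biUnion_of_mem J hi) (hJ i hi)
  · rw [Finset.biUnion_biUnion]
    exact Finset.biUnion_congr rfl hXJ

/-- The elements `a` of `s` such that every larger element of `s` exceeds `h a`; the maximum of `s`
always qualifies. -/
def bigGaps (h : ℕ → ℕ) (s : Finset ℕ) : Finset ℕ :=
  s.filter fun a => ∀ b ∈ s, a < b → h a < b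

theorem card_bigGaps_union_of_gap {h : ℕ → ℕ} {s t : Finset ℕ} (hst : blockLt s t)
    {m : ℕ} (hm : m ∈ s) (hmax : ∀ b ∈ s, b ≤ m) (hgap : ∀ b ∈ t, h m < b) :
    (bigGaps h (s ∪ t)).card = (bigGaps h s).card + (bigGaps h t).card := by
  rw [← Finset.card_union_of_disjoint]
  · congr 1
    ext a
    simp only [bigGaps, Finset.mem_filter, Finset.mem_union]
    grind [blockLt]
  · rw [Finset.disjoint_left]
    simp only [bigGaps, Finset.mem_filter]
    grind [blockLt]

theorem card_bigGaps_union_of_not_gap {h : ℕ → ℕ} {s t : Finset ℕ} (hst : blockLt s t)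
    {m : ℕ} (hm : m ∈ s) (hmax : ∀ b ∈ s, b ≤ m) (hgap : ¬ ∀ b ∈ t, h m < b) :
    (bigGaps h (s ∪ t)).card + 1 = (bigGaps h s).card + (bigGaps h t).card := by
  have hmem : m ∉ bigGaps h (s ∪ t) := by
    simp only [bigGaps, Finset.mem_filter, Finset.mem_union]
    grind [blockLt]
  rw [← Finset.card_insert_of_notMem hmem, ← Finset.card_union_of_disjoint]
  · congr 1
    ext a
    simp only [bigGaps, Finset.mem_filter, Finset.mem_union, Finset.mem_insert]
    grind [blockLt]
  · rw [Finset.disjoint_left]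
    simp only [bigGaps, Finset.mem_filter]
    grind [blockLt]

/-- A block sequence on whose unions the parity of the number of big gaps is constant has a big gap
between any two of its blocks. -/
theorem IsBlockSeq.gap_of_parity_const {h : ℕ → ℕ} {Y : ℕ → Finset ℕ} (hY : IsBlockSeq Y)
    (hpar : ∀ s t, InUnions Y s → InUnions Y t →
      (Even (bigGaps h s).card ↔ Even (bigGaps h t).card))
    {i j : ℕ} (hij : i < j) {m : ℕ} (hm : m ∈ Y i) (hmax : ∀ b ∈ Y i, b ≤ m) :
    ∀ b ∈ Y j, h m < b := by
  have hunion (k l : ℕ) : InUnions Y (Y k ∪ Y l) := ⟨{k, l}, by simp, by simp⟩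
  have heven : Even (bigGaps h (Y i)).card := by
    have hlt : i < h m + i + 1 := by omega
    have hcard := card_bigGaps_union_of_gap (h := h) (hY.blockLt_of_lt hlt) hm hmax
      fun b hb => by have := hY.le_of_mem hb; omega
    have h1 := hpar _ _ (hunion i (h m + i + 1)) (inUnions_apply Y i)
    have h2 := hpar _ _ (inUnions_apply Y (h m + i + 1)) (inUnions_apply Y i)
    grind
  by_contra hgap
  have hcard := card_bigGaps_union_of_not_gap (hY.blockLt_of_lt hij) hm hmax hgap
  have h1 := hpar _ _ (hunion i j) (inUnions_apply Y i)
  have h2 := hpar _ _ (inUnions_apply Y j) (inUnions_apply Y i)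
  grind

/-- Every member of a Matet-adequate family has a condensation in the family whose gaps outgrow a
given function. -/
theorem MatetAdequate.exists_sparse {H : Set (ℕ → Finset ℕ)} (hH : MatetAdequate H)
    {X : ℕ → Finset ℕ} (hX : X ∈ H) (h : ℕ → ℕ) :
    ∃ Y ∈ H, Condensation Y X ∧ ∀ i j, i < j → ∀ m ∈ Y i, (∀ b ∈ Y i, b ≤ m) →
      ∀ b ∈ Y j, h m < b := by
  obtain ⟨-, hblock, -, -, -, hcol⟩ := hH
  obtain ⟨Y, hY, hYX, c, hc⟩ := hcol X hX fun s => if Even (bigGaps h s).card then 0 else 1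
  refine ⟨Y, hY, hYX, fun i j hij m hm hmax => ?_⟩
  refine (hblock Y hY).gap_of_parity_const (fun s t hs ht => ?_) hij hm hmax
  have hst := (hc s hs).trans (hc t ht).symm
  by_cases h1 : Even (bigGaps h s).card <;> by_cases h2 : Even (bigGaps h t).card <;>
    simp only [h1, h2, if_true, if_false] at hst ⊢ <;> simp at hst

theorem MatetAdequate.tail_mem {H : Set (ℕ → Finset ℕ)} (hH : MatetAdequate H)
    {Y : ℕ → Finset ℕ} (hY : Y ∈ H) : (fun i => Y (i + 1)) ∈ H := by
  obtain ⟨-, hblock, -, hup, -, -⟩ := hH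
  have hbY := hblock Y hY
  obtain ⟨m, hm⟩ := (hbY 0).1
  refine hup Y hY _ (fun i => hbY (i + 1)) ⟨m, fun i hi => ?_⟩
  cases i with
  | zero => exact absurd (hi m hm) (lt_irrefl m)
  | succ i => exact inUnions_apply (fun i => Y (i + 1)) i

/-- Diagonal intersections exist in Matet-adequate families: there is
`X ∈ H`, `X ≤ X₀`, such that for every `s ∈ [X]` with maximum `m`, every
block of the tail `X/s` (blocks all of whose elements exceed `m`) lies in
`[X_{m+1}]`. -/
theorem diagonal_intersection (H : Set (ℕ → Finset ℕ)) (hH : MatetAdequate H)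
    (f : ℕ → ℕ → Finset ℕ) (hf : ∀ n, f n ∈ H)
    (hdesc : ∀ n, Condensation (f (n + 1)) (f n)) :
    ∃ X ∈ H, Condensation X (f 0) ∧
      ∀ s : Finset ℕ, InUnions X s → ∀ m ∈ s, (∀ b ∈ s, b ≤ m) →
        ∀ i, (∀ a ∈ X i, m < a) → InUnions (f (m + 1)) (X i) := by
  obtain ⟨Z, hZ, hZf⟩ := hH.2.2.2.2.1 f hf hdesc
  choose g hg using hZf
  obtain ⟨Y, hY, hYZ, hgap⟩ := hH.exists_sparse hZ fun m => g 0 + g (m + 1)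
  have hbY := hH.2.1 Y hY
  have key (n i : ℕ) (hi : ∀ a ∈ Y i, g n < a) : InUnions (f n) (Y i) := by
    obtain ⟨I, hI, hYI⟩ := hYZ i
    rw [hYI]
    refine InUnions.biUnion hI fun k hk => hg n k fun a ha => hi a ?_
    rw [hYI]
    exact Finset.mem_biUnion.2 ⟨k, hk, ha⟩
  refine ⟨_, hH.tail_mem hY, fun i => key 0 (i + 1) fun a ha => ?_, ?_⟩
  · have := hgap 0 (i + 1) i.succ_pos _ ((Y 0).max'_mem (hbY 0).1) (Y 0).le_max' a ha
    omega
  · rintro s ⟨I, -, rfl⟩ m hm hmax i hi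
    obtain ⟨j, hj, hmj⟩ := Finset.mem_biUnion.1 hm
    have hji : j + 1 < i + 1 := by
      by_contra hle
      obtain ⟨a, ha⟩ := (hbY (i + 1)).1
      have hma := hi a ha
      rcases (not_lt.1 hle).lt_or_eq with hlt | heq
      · exact lt_asymm hma (hbY.blockLt_of_lt hlt a ha m hmj)
      · exact lt_irrefl m (hi m (by simpa [heq] using hmj))
    refine key (m + 1) (i + 1) fun a ha => ?_
    have := hgap (j + 1) (i + 1) hji m hmj
      (fun b hb => hmax b (Finset.mem_biUnion.2 ⟨j, hj, hb⟩)) a ha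
    omega
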